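/- Let δ > 0 and set c_δ := 3/δ³. Let u : ℝ² → ℝ² have both components polynomials of total degree at most 3. Then for every x ∈ ℝ², 2 c_δ ∫_{{y : 0 < |y−x|₂ ≤ δ}} ((x−y)(x−y)ᵀ / |x−y|₂³) (u(x) − u(y)) dy = −(π/4) Δu(x) − (π/2) ∇(div u)(x), where Δ acts componentwise; i.e., the correctly scaled linear bond-based peridynamic operator coincides with the local Navier operator −P₀ u = −(π/4)Δu − (π/2)∇ div u on vector polynomials of degree up to three. (The integrand, with operator norm 1/|x−y| times |u(x)−u(y)|, is Lebesgue integrable, so no principal value is needed.) -/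

import Mathlib

open MeasureTheory

noncomputable section

abbrev E2 := EuclideanSpace ℝ (Fin 2)

/-- Componentwise Laplacian of a vector field on `ℝ²`. -/
def vecLaplacian (u : E2 → E2) (x : E2) : E2 :=
  ∑ i : Fin 2,
    fderiv ℝ (fun z => fderiv ℝ u z (EuclideanSpace.single i 1)) x (EuclideanSpace.single i 1)

/-- Divergence of a vector field on `ℝ²`. -/
def diverg (u : E2 → E2) (x : E2) : ℝ :=
  ∑ i : Fin 2, fderiv ℝ u x (EuclideanSpace.single i 1) i

/-- Gradient of the divergence of a vector field on `ℝ²`. -/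
def gradDiv (u : E2 → E2) (x : E2) : E2 :=
  (WithLp.equiv 2 (Fin 2 → ℝ)).symm
    (fun i => fderiv ℝ (diverg u) x (EuclideanSpace.single i 1))

end

open scoped RealInnerProductSpace


open MvPolynomial in
lemma hasFDerivAt_mvPolynomial_eval {ι : Type*} [Fintype ι] (q : MvPolynomial ι ℝ)
    (z : EuclideanSpace ℝ ι) :
    HasFDerivAt (fun y : EuclideanSpace ℝ ι => eval (fun j => y j) q)
      (∑ i, eval (fun j => z j) (pderiv i q) • EuclideanSpace.proj (𝕜 := ℝ) i) z := by
  classical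
  induction q using MvPolynomial.induction_on with
  | C a => simpa using hasFDerivAt_const a z
  | add p q hp hq =>
    refine ((hp.add hq).congr_of_eventuallyEq (.of_forall fun y => by simp)).congr_fderiv ?_
    simp [add_smul, Finset.sum_add_distrib]
  | mul_X p n hp =>
    have hn : HasFDerivAt (fun y : EuclideanSpace ℝ ι => y n) (EuclideanSpace.proj (𝕜 := ℝ) n) z :=
      (EuclideanSpace.proj (𝕜 := ℝ) n).hasFDerivAt
    refine ((hp.mul hn).congr_of_eventuallyEq (.of_forall fun y => by simp)).congr_fderiv ?_
    ext v
    simp [pderiv_X, Pi.single_apply, add_mul, Finset.sum_add_distrib, Finset.mul_sum, mul_assoc,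
      apply_ite]

open MvPolynomial in
lemma eval_second_difference (q : MvPolynomial (Fin 2) ℝ) (hq : q.totalDegree ≤ 3)
    (x z : Fin 2 → ℝ) :
    2 * eval x q - eval (x - z) q - eval (x + z) q =
      -(eval x (pderiv 0 (pderiv 0 q)) * z 0 ^ 2 +
        2 * eval x (pderiv 0 (pderiv 1 q)) * (z 0 * z 1) +
        eval x (pderiv 1 (pderiv 1 q)) * z 1 ^ 2) := by
  have key : ∀ d ∈ q.support, ∀ a : ℝ,
      2 * eval x (monomial d a) - eval (x - z) (monomial d a) - eval (x + z) (monomial d a) =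
      -(eval x (pderiv 0 (pderiv 0 (monomial d a))) * z 0 ^ 2 +
        2 * eval x (pderiv 0 (pderiv 1 (monomial d a))) * (z 0 * z 1) +
        eval x (pderiv 1 (pderiv 1 (monomial d a))) * z 1 ^ 2) := by
    intro d hd a
    have hdeg : d 0 + d 1 ≤ 3 := by
      have := (le_totalDegree hd).trans hq
      simpa [Finsupp.sum_fintype] using this
    simp only [pderiv_monomial, eval_monomial, Finsupp.prod_fintype, pow_zero, implies_true,
      Fin.prod_univ_two, Finsupp.tsub_apply, Pi.sub_apply, Pi.add_apply, Finsupp.single_apply]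
    generalize d 0 = m at *
    generalize d 1 = n at *
    have hm : m ≤ 3 := by omega
    have hn : n ≤ 3 := by omega
    interval_cases m <;> interval_cases n <;> first | omega | (simp; try ring)
  rw [q.as_sum]
  simp only [map_sum, Finset.mul_sum, Finset.sum_mul, ← Finset.sum_sub_distrib,
    ← Finset.sum_add_distrib, ← Finset.sum_neg_distrib]
  exact Finset.sum_congr rfl fun d hd => key d hd _

lemma integral_trig_quartic (a b c d e : ℝ) :
    ∫ θ in -Real.pi..Real.pi,
      (a * Real.cos θ ^ 4 + b * (Real.cos θ ^ 3 * Real.sin θ) +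
        c * (Real.cos θ ^ 2 * Real.sin θ ^ 2) + d * (Real.cos θ * Real.sin θ ^ 3) +
        e * Real.sin θ ^ 4) = Real.pi / 4 * (3 * a + c + 3 * e) := by
  have key : ∀ θ : ℝ, HasDerivAt (fun θ : ℝ =>
      a * (3 / 8 * θ + 3 / 8 * (Real.sin θ * Real.cos θ) + 1 / 4 * (Real.cos θ ^ 3 * Real.sin θ)) +
      b * (-1 / 4 * Real.cos θ ^ 4) +
      c * (1 / 8 * θ - 1 / 8 * (Real.sin θ * Real.cos θ * (Real.cos θ ^ 2 - Real.sin θ ^ 2))) +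
      d * (1 / 4 * Real.sin θ ^ 4) +
      e * (3 / 8 * θ - 3 / 8 * (Real.sin θ * Real.cos θ) - 1 / 4 * (Real.sin θ ^ 3 * Real.cos θ)))
      (a * Real.cos θ ^ 4 + b * (Real.cos θ ^ 3 * Real.sin θ) +
        c * (Real.cos θ ^ 2 * Real.sin θ ^ 2) + d * (Real.cos θ * Real.sin θ ^ 3) +
        e * Real.sin θ ^ 4) θ := by
    intro θ
    have hs := Real.hasDerivAt_sin θ
    have hc := Real.hasDerivAt_cos θ
    have hi := hasDerivAt_id' θ
    refine HasDerivAt.congr_deriv (((((((hi.const_mul (3 / 8)).add ((hs.mul hc).const_mul (3 / 8))).add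
      (((hc.pow 3).mul hs).const_mul (1 / 4))).const_mul a).add
      (((hc.pow 4).const_mul (-1 / 4)).const_mul b)).add
      (((hi.const_mul (1 / 8)).sub
        (((hs.mul hc).mul ((hc.pow 2).sub (hs.pow 2))).const_mul (1 / 8))).const_mul c)).add
      (((hs.pow 4).const_mul (1 / 4)).const_mul d) |>.add
      ((((hi.const_mul (3 / 8)).sub ((hs.mul hc).const_mul (3 / 8))).sub
        (((hs.pow 3).mul hc).const_mul (1 / 4))).const_mul e)) ?_
    have h := Real.sin_sq_add_cos_sq θ
    simp
    generalize Real.sin θ = s at *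
    generalize Real.cos θ = t at *
    grind
  rw [intervalIntegral.integral_eq_sub_of_hasDerivAt (fun θ _ => key θ)
    (Continuous.intervalIntegrable (by fun_prop) _ _)]
  simp
  ring

lemma integral_ball_homogeneous (δ : ℝ) (hδ : 0 < δ) (H : ℝ → ℝ → ℝ)
    (hH : ∀ r s t, H (r * s) (r * t) = r ^ 4 * H s t) :
    ∫ z in {z : EuclideanSpace ℝ (Fin 2) | 0 < ‖z‖ ∧ ‖z‖ ≤ δ}, H (z 0) (z 1) / ‖z‖ ^ 3 =
      δ ^ 3 / 3 * ∫ θ in -Real.pi..Real.pi, H (Real.cos θ) (Real.sin θ) := by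
  have hS : MeasurableSet {z : EuclideanSpace ℝ (Fin 2) | 0 < ‖z‖ ∧ ‖z‖ ≤ δ} := by
    measurability
  rw [← integral_indicator hS,
    ← (Complex.orthonormalBasisOneI.repr.measurePreserving).integral_comp
      Complex.orthonormalBasisOneI.repr.toHomeomorph.measurableEmbedding,
    ← Complex.integral_comp_polarCoord_symm]
  have h1 : ∀ q ∈ polarCoord.target, q.1 • Set.indicator
      {z : EuclideanSpace ℝ (Fin 2) | 0 < ‖z‖ ∧ ‖z‖ ≤ δ} (fun z => H (z 0) (z 1) / ‖z‖ ^ 3)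
      (Complex.orthonormalBasisOneI.repr (Complex.polarCoord.symm q)) =
      Set.indicator (Set.Iic δ) (fun r : ℝ => r ^ 2) q.1 * H (Real.cos q.2) (Real.sin q.2) := by
    rintro ⟨r, θ⟩ ⟨hr : 0 < r, -⟩
    have hn : ‖Complex.polarCoord.symm (r, θ)‖ = r := by
      rw [Complex.norm_polarCoord_symm, abs_of_pos hr]
    simp only [Set.indicator, Set.mem_ofPred_eq, LinearIsometryEquiv.norm_map, hn, hr, true_and,
      Set.mem_Iic]
    split_ifs with h
    · rw [Complex.orthonormalBasisOneI_repr_apply]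
      have e0 : (Complex.polarCoord.symm (r, θ)).re = r * Real.cos θ := by
        simp [Complex.polarCoord_symm_apply, -Complex.ofReal_cos, -Complex.ofReal_sin]
      have e1 : (Complex.polarCoord.symm (r, θ)).im = r * Real.sin θ := by
        simp [Complex.polarCoord_symm_apply, -Complex.ofReal_cos, -Complex.ofReal_sin]
      simp only [Matrix.cons_val_zero, Matrix.cons_val_one, e0, e1, hH, smul_eq_mul]
      field_simp
    · simp
  rw [setIntegral_congr_fun polarCoord.open_target.measurableSet h1, polarCoord_target,
    Measure.volume_eq_prod,
    setIntegral_prod_mul (fun r : ℝ => Set.indicator (Set.Iic δ) (fun r : ℝ => r ^ 2) r)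
      (fun θ => H (Real.cos θ) (Real.sin θ)),
    setIntegral_indicator measurableSet_Iic, Set.Ioi_inter_Iic,
    ← intervalIntegral.integral_of_le hδ.le, integral_pow, ← integral_Ioc_eq_integral_Ioo,
    ← intervalIntegral.integral_of_le (by linarith [Real.pi_pos])]
  norm_num

lemma pderiv_pderiv_comm {σ R : Type*} [CommSemiring R] (i j : σ) (q : MvPolynomial σ R) :
    MvPolynomial.pderiv i (MvPolynomial.pderiv j q) =
      MvPolynomial.pderiv j (MvPolynomial.pderiv i q) := by
  classical
  induction q using MvPolynomial.induction_on with
  | C a => simp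
  | add p q hp hq => simp [hp, hq]
  | mul_X p n hp =>
    simp only [MvPolynomial.pderiv_mul, MvPolynomial.pderiv_X, Pi.single_apply, map_add, hp]
    split_ifs <;> simp [add_comm, add_left_comm]

lemma fderiv_eq_of_polynomial (p : Fin 2 → MvPolynomial (Fin 2) ℝ) (u : E2 → E2)
    (hu : ∀ x i, u x i = MvPolynomial.eval (fun j => x j) (p i)) (z : E2) (i j : Fin 2) :
    fderiv ℝ u z (EuclideanSpace.single i 1) j =
      MvPolynomial.eval (fun k => z k) (MvPolynomial.pderiv i (p j)) := by
  have hd : DifferentiableAt ℝ u z := by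
    rw [differentiableAt_euclidean]
    intro k
    simp only [hu]
    exact (hasFDerivAt_mvPolynomial_eval (p k) z).differentiableAt
  have h1 : HasFDerivAt (fun y => u y j) (PiLp.proj _ _ j ∘L fderiv ℝ u z) z :=
    HasFDerivAt.comp (f := u) (g := fun w : E2 => w j) z (PiLp.hasFDerivAt_apply 2 (u z) j)
      hd.hasFDerivAt
  simp only [hu] at h1
  have := h1.unique (hasFDerivAt_mvPolynomial_eval (p j) z)
  have := congrArg (fun L => L (EuclideanSpace.single i (1 : ℝ))) this
  fin_cases i <;> simpa using this

lemma vecLaplacian_of_polynomial (p : Fin 2 → MvPolynomial (Fin 2) ℝ) (u : E2 → E2)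
    (hu : ∀ x i, u x i = MvPolynomial.eval (fun j => x j) (p i)) (x : E2) (j : Fin 2) :
    vecLaplacian u x j = ∑ i, MvPolynomial.eval (fun k => x k)
      (MvPolynomial.pderiv i (MvPolynomial.pderiv i (p j))) := by
  simp only [vecLaplacian, WithLp.ofLp_sum, Finset.sum_apply]
  refine Finset.sum_congr rfl fun i _ => ?_
  exact fderiv_eq_of_polynomial (fun j => MvPolynomial.pderiv i (p j)) _
    (fun z k => fderiv_eq_of_polynomial p u hu z i k) x i j

lemma gradDiv_of_polynomial (p : Fin 2 → MvPolynomial (Fin 2) ℝ) (u : E2 → E2)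
    (hu : ∀ x i, u x i = MvPolynomial.eval (fun j => x j) (p i)) (x : E2) (j : Fin 2) :
    gradDiv u x j = ∑ i, MvPolynomial.eval (fun k => x k)
      (MvPolynomial.pderiv j (MvPolynomial.pderiv i (p i))) := by
  have hdiv : diverg u = fun y => MvPolynomial.eval (fun k => y k)
      (∑ i, MvPolynomial.pderiv i (p i)) := by
    ext y
    simp [diverg, fderiv_eq_of_polynomial p u hu]
  simp only [gradDiv, hdiv, (hasFDerivAt_mvPolynomial_eval _ _).fderiv]
  fin_cases j <;> simp

lemma measurableSet_punctured_closedBall (δ : ℝ) :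
    MeasurableSet {z : E2 | 0 < ‖z‖ ∧ ‖z‖ ≤ δ} := by
  measurability

lemma integrableOn_kernel (δ : ℝ) (x : E2) (u : E2 → E2) (hu : ContDiff ℝ 1 u) :
    IntegrableOn (fun z : E2 => (⟪z, u x - u (x - z)⟫ / ‖z‖ ^ 3) • z)
      {z | 0 < ‖z‖ ∧ ‖z‖ ≤ δ} := by
  obtain ⟨K, hK⟩ := hu.contDiffOn.exists_lipschitzOnWith one_ne_zero
    (convex_closedBall x δ) (isCompact_closedBall x δ)
  refine Measure.integrableOn_of_bounded (M := (K : ℝ)) ?_ ?_ ?_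
  · refine ne_top_of_le_ne_top (measure_closedBall_lt_top (x := (0 : E2)) (r := δ)).ne
      (measure_mono fun z hz => ?_)
    simpa using hz.2
  · have := hu.continuous
    exact Measurable.aestronglyMeasurable (by fun_prop)
  · refine ae_restrict_of_forall_mem (measurableSet_punctured_closedBall δ) ?_
    rintro z ⟨hz, hzδ⟩
    have h1 := hK.norm_sub_le (x := x) (y := x - z)
      (Metric.mem_closedBall_self (hz.le.trans hzδ)) (by simpa [dist_eq_norm] using hzδ)
    rw [sub_sub_cancel] at h1
    rw [norm_smul, norm_div, norm_pow, norm_norm]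
    calc ‖⟪z, u x - u (x - z)⟫‖ / ‖z‖ ^ 3 * ‖z‖
        ≤ (‖z‖ * ((K : ℝ) * ‖z‖)) / ‖z‖ ^ 3 * ‖z‖ := by
          gcongr
          exact (norm_inner_le_norm _ _).trans (by gcongr)
      _ = (K : ℝ) := by field_simp

lemma setIntegral_sub_left (δ : ℝ) (x : E2) (g : E2 → E2) :
    ∫ y in {y : E2 | 0 < dist y x ∧ dist y x ≤ δ}, g (x - y) =
      ∫ z in {z : E2 | 0 < ‖z‖ ∧ ‖z‖ ≤ δ}, g z := by
  rw [← integral_indicator (measurableSet_punctured_closedBall δ),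
    ← integral_sub_left_eq_self _ volume x, ← integral_indicator]
  · refine integral_congr_ae (.of_forall fun y => ?_)
    simp only [Set.indicator, Set.mem_ofPred_eq, dist_eq_norm, norm_sub_rev y x]
    congr
  · exact (measurableSet_Ioi.preimage (by fun_prop : Measurable fun y => dist y x)).inter
      (measurableSet_Iic.preimage (by fun_prop : Measurable fun y => dist y x))

lemma setIntegral_punctured_ball_neg (δ : ℝ) (g : E2 → ℝ) :
    ∫ z in {z : E2 | 0 < ‖z‖ ∧ ‖z‖ ≤ δ}, g (-z) =
      ∫ z in {z : E2 | 0 < ‖z‖ ∧ ‖z‖ ≤ δ}, g z := by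
  rw [← integral_indicator (measurableSet_punctured_closedBall δ),
    ← integral_indicator (measurableSet_punctured_closedBall δ), ← integral_neg_eq_self _ volume]
  simp [Set.indicator]

/-- the correctly scaled linear bond-based peridynamic operator coincides
with the local Navier operator `-P₀u = -(π/4)Δu - (π/2)∇ div u` on vector polynomials of
degree up to three.  The matrix kernel acts as
`((x-y)(x-y)ᵀ/|x-y|³)(u(x)-u(y)) = (⟪x-y, u(x)-u(y)⟫/|x-y|³) • (x-y)`. -/
theorem peridynamic_on_cubics
    (δ : ℝ) (hδ : 0 < δ)
    (c : ℝ) (hc : c = 3 / δ ^ 3)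
    (p : Fin 2 → MvPolynomial (Fin 2) ℝ) (hp : ∀ i, (p i).totalDegree ≤ 3)
    (u : E2 → E2)
    (hu : ∀ x i, u x i = MvPolynomial.eval (fun j => x j) (p i))
    (x : E2) :
    (2 * c) • ∫ y in {y : E2 | 0 < dist y x ∧ dist y x ≤ δ},
        ((⟪x - y, u x - u y⟫ / dist x y ^ 3) • (x - y) : E2)
      = -((Real.pi / 4) • vecLaplacian u x) - (Real.pi / 2) • gradDiv u x := by
  have hC : ContDiff ℝ 1 u := by
    rw [contDiff_euclidean]
    intro i
    simp only [hu]
    simp only [MvPolynomial.eval_eq']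
    fun_prop
  have hker := integrableOn_kernel δ x u hC
  have hker' := fun i : Fin 2 => ContinuousLinearMap.integrable_comp
    (EuclideanSpace.proj i : E2 →L[ℝ] ℝ) hker
  have hshift : ∫ y in {y : E2 | 0 < dist y x ∧ dist y x ≤ δ},
        ((⟪x - y, u x - u y⟫ / dist x y ^ 3) • (x - y) : E2) =
      ∫ z in {z : E2 | 0 < ‖z‖ ∧ ‖z‖ ≤ δ}, (⟪z, u x - u (x - z)⟫ / ‖z‖ ^ 3) • z := by
    rw [← setIntegral_sub_left δ x]
    simp [dist_eq_norm]
  set A : Fin 2 → Fin 2 → Fin 2 → ℝ := fun i k j => MvPolynomial.eval (fun l => x l)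
      (MvPolynomial.pderiv i (MvPolynomial.pderiv k (p j))) with hA
  have hcomm : ∀ j, A 1 0 j = A 0 1 j := fun j => by
    simp only [hA]
    rw [pderiv_pderiv_comm]
  have hcomp : ∀ i : Fin 2,
      (∫ z in {z : E2 | 0 < ‖z‖ ∧ ‖z‖ ≤ δ}, (⟪z, u x - u (x - z)⟫ / ‖z‖ ^ 3) • z) i =
      -(1 / 2) * ∫ z in {z : E2 | 0 < ‖z‖ ∧ ‖z‖ ≤ δ},
        ((z 0 * (A 0 0 0 * z 0 ^ 2 + 2 * A 0 1 0 * (z 0 * z 1) + A 1 1 0 * z 1 ^ 2) +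
          z 1 * (A 0 0 1 * z 0 ^ 2 + 2 * A 0 1 1 * (z 0 * z 1) + A 1 1 1 * z 1 ^ 2)) * z i) /
            ‖z‖ ^ 3 := by
    intro i
    have hi : Integrable (fun z : E2 => ((⟪z, u x - u (x - z)⟫ / ‖z‖ ^ 3) • z) i)
      (volume.restrict {z : E2 | 0 < ‖z‖ ∧ ‖z‖ ≤ δ}) := hker' i
    have hneg : Integrable (fun z : E2 => ((⟪-z, u x - u (x - -z)⟫ / ‖-z‖ ^ 3) • -z) i)
        (volume.restrict {z : E2 | 0 < ‖z‖ ∧ ‖z‖ ≤ δ}) := by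
      have h := ((integrable_indicator_iff (measurableSet_punctured_closedBall δ)).2 hi).comp_neg
      refine (integrable_indicator_iff (measurableSet_punctured_closedBall δ)).1
        (h.congr (.of_forall fun z => ?_))
      simp [Set.indicator]
    have hsum := integral_add hi hneg
    rw [setIntegral_punctured_ball_neg δ
      (fun z => ((⟪z, u x - u (x - z)⟫ / ‖z‖ ^ 3) • z) i)] at hsum
    rw [eval_integral_piLp hker']
    have hpt : ∀ z : E2, ((⟪z, u x - u (x - z)⟫ / ‖z‖ ^ 3) • z) i +
        ((⟪-z, u x - u (x - -z)⟫ / ‖-z‖ ^ 3) • -z) i =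
        -(((z 0 * (A 0 0 0 * z 0 ^ 2 + 2 * A 0 1 0 * (z 0 * z 1) + A 1 1 0 * z 1 ^ 2) +
          z 1 * (A 0 0 1 * z 0 ^ 2 + 2 * A 0 1 1 * (z 0 * z 1) + A 1 1 1 * z 1 ^ 2)) * z i) /
            ‖z‖ ^ 3) := by
      intro z
      have h0 := eval_second_difference (p 0) (hp 0) (fun l => x l) (fun l => z l)
      have h1 := eval_second_difference (p 1) (hp 1) (fun l => x l) (fun l => z l)
      have e1 : ∀ j, u (x - z) j = MvPolynomial.eval ((fun l => x l) - fun l => z l) (p j) :=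
        fun j => hu _ j
      have e2 : ∀ j, u (x + z) j = MvPolynomial.eval ((fun l => x l) + fun l => z l) (p j) :=
        fun j => hu _ j
      simp only [← e1, ← e2, ← hu] at h0 h1
      change _ = -(A 0 0 0 * _ + 2 * A 0 1 0 * _ + A 1 1 0 * _) at h0
      change _ = -(A 0 0 1 * _ + 2 * A 0 1 1 * _ + A 1 1 1 * _) at h1
      simp only [sub_neg_eq_add, norm_neg, PiLp.inner_apply, Fin.sum_univ_two, PiLp.smul_apply,
        PiLp.neg_apply, PiLp.sub_apply, smul_eq_mul, RCLike.inner_apply, conj_trivial]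
      linear_combination (z 0 * z i / ‖z‖ ^ 3) * h0 + (z 1 * z i / ‖z‖ ^ 3) * h1
    simp only [hpt, integral_neg] at hsum
    linarith
  have hmom : ∀ i : Fin 2, ∫ z in {z : E2 | 0 < ‖z‖ ∧ ‖z‖ ≤ δ},
        ((z 0 * (A 0 0 0 * z 0 ^ 2 + 2 * A 0 1 0 * (z 0 * z 1) + A 1 1 0 * z 1 ^ 2) +
          z 1 * (A 0 0 1 * z 0 ^ 2 + 2 * A 0 1 1 * (z 0 * z 1) + A 1 1 1 * z 1 ^ 2)) * z i) /
            ‖z‖ ^ 3 =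
      δ ^ 3 / 3 * (Real.pi / 4 * (A 0 0 i + A 1 1 i) + Real.pi / 2 * (A i 0 0 + A i 1 1)) := by
    intro i
    fin_cases i
    · refine (integral_ball_homogeneous δ hδ (fun s t =>
        (s * (A 0 0 0 * s ^ 2 + 2 * A 0 1 0 * (s * t) + A 1 1 0 * t ^ 2) +
          t * (A 0 0 1 * s ^ 2 + 2 * A 0 1 1 * (s * t) + A 1 1 1 * t ^ 2)) * s)
        (fun r s t => by ring)).trans ?_
      have := integral_trig_quartic (A 0 0 0) (2 * A 0 1 0 + A 0 0 1) (A 1 1 0 + 2 * A 0 1 1)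
        (A 1 1 1) 0
      congr 1
      refine (intervalIntegral.integral_congr fun θ _ => ?_).trans (this.trans ?_)
      · dsimp only
        ring
      · dsimp
        ring
    · refine (integral_ball_homogeneous δ hδ (fun s t =>
        (s * (A 0 0 0 * s ^ 2 + 2 * A 0 1 0 * (s * t) + A 1 1 0 * t ^ 2) +
          t * (A 0 0 1 * s ^ 2 + 2 * A 0 1 1 * (s * t) + A 1 1 1 * t ^ 2)) * t)
        (fun r s t => by ring)).trans ?_
      have := integral_trig_quartic 0 (A 0 0 0) (2 * A 0 1 0 + A 0 0 1) (A 1 1 0 + 2 * A 0 1 1)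
        (A 1 1 1)
      congr 1
      refine (intervalIntegral.integral_congr fun θ _ => ?_).trans (this.trans ?_)
      · dsimp only
        ring
      · dsimp
        rw [hcomm]
        ring
  rw [hshift]
  ext i
  have hL : vecLaplacian u x i = A 0 0 i + A 1 1 i := by
    rw [vecLaplacian_of_polynomial p u hu, Fin.sum_univ_two]
  have hG : gradDiv u x i = A i 0 0 + A i 1 1 := by
    rw [gradDiv_of_polynomial p u hu, Fin.sum_univ_two]
  simp only [PiLp.smul_apply, PiLp.sub_apply, PiLp.neg_apply, smul_eq_mul, hcomp, hmom, hL, hG, hc]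
  field_simp
  ring
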